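/- Let n̄ = (n₁,…,n_r) with n₁ ≤ ··· ≤ n_r. If the projective product manifold P_{n̄} admits a smooth immersion into R^M, then there exists a Hopf-type map P_{n̄} × P^{|n̄|+r-1} → P^{M+r-1}, i.e., a map classifying the Hopf line bundle of the projectivization of (|n̄|+r)ξ_{n̄}, using the identification P((|n̄|+r)ξ_{n̄}) = P_{n̄} × P^{|n̄|+r-1}. -/

import Mathlib

noncomputable section

open unitInterval Set

/-- The double evaluation map `X^{[0,1]} → X × X`, sending a path `γ : [0,1] → X`
to the pair of its endpoints `(γ(0), γ(1))`. -/
def pathEval (X : Type*) [TopologicalSpace X] (γ : C(I, X)) : X × X := (γ 0, γ 1)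

/-- `X × X` admits a cover by `k + 1` open sets on each of which the double evaluation
map `X^{[0,1]} → X × X` admits a continuous section. -/
def TCCover (X : Type*) [TopologicalSpace X] (k : ℕ) : Prop :=
  ∃ U : Fin (k + 1) → Set (X × X),
    (∀ i, IsOpen (U i)) ∧ (⋃ i, U i) = Set.univ ∧
    ∀ i, ∃ s : C(U i, C(I, X)), ∀ u : U i, pathEval X (s u) = (u : X × X)

/-- Farber's (reduced) topological complexity, as an element of `ℕ∞`. -/
def topComplexity (X : Type*) [TopologicalSpace X] : ℕ∞ :=
  sInf {c : ℕ∞ | ∃ k : ℕ, TCCover X k ∧ c = k}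

/-- `X × X` admits a cover by `k + 1` `G`-invariant open sets (for the diagonal `G`-action)
on each of which the double evaluation map admits a continuous `G`-equivariant section. -/
def EqTCCover (G X : Type*) [Group G] [TopologicalSpace X] [MulAction G X] (k : ℕ) : Prop :=
  ∃ U : Fin (k + 1) → Set (X × X),
    (∀ i, IsOpen (U i)) ∧ (⋃ i, U i) = Set.univ ∧
    (∀ i (g : G) p, p ∈ U i → g • p ∈ U i) ∧
    ∀ i, ∃ s : C(U i, C(I, X)),
      (∀ u : U i, pathEval X (s u) = (u : X × X)) ∧
      ∀ (g : G) (u : U i) (hg : g • (u : X × X) ∈ U i) (t : I),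
        (s ⟨g • (u : X × X), hg⟩) t = g • (s u) t

/-- The (reduced) equivariant topological complexity `TC_G(X)` of Colman–Grant,
as an element of `ℕ∞`. -/
def eqTC (G X : Type*) [Group G] [TopologicalSpace X] [MulAction G X] : ℕ∞ :=
  sInf {c : ℕ∞ | ∃ k : ℕ, EqTCCover G X k ∧ c = k}

open Metric

/-- `S_{n̄} = S^{n₁} × ⋯ × S^{n_r}`, the product of unit spheres. -/
abbrev SphereProd {r : ℕ} (n : Fin r → ℕ) : Type :=
  Π i : Fin r, Metric.sphere (0 : EuclideanSpace ℝ (Fin (n i + 1))) 1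

/-- The setoid on `S_{n̄}` identifying each point with its image under the diagonal
antipodal involution. -/
def ppsSetoid {r : ℕ} (n : Fin r → ℕ) : Setoid (SphereProd n) :=
  ⟨fun x y => y = x ∨ y = -x, by
    constructor
    · intro x; exact Or.inl rfl
    · rintro x y (rfl | rfl)
      · exact Or.inl rfl
      · right; simp
    · rintro x y z (rfl | rfl) (rfl | rfl)
      · exact Or.inl rfl
      · exact Or.inr rfl
      · exact Or.inr rfl
      · left; simp⟩

/-- Davis' projective product space `P_{n̄}`: the quotient of `S_{n̄}` by the diagonal
(free) antipodal `ℤ/2`-action. -/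
def PPS {r : ℕ} (n : Fin r → ℕ) : Type := Quotient (ppsSetoid n)

instance {r : ℕ} (n : Fin r → ℕ) : TopologicalSpace (PPS n) :=
  instTopologicalSpaceQuotient

/-- The quotient map `S_{n̄} → P_{n̄}`. -/
def ppsMk {r : ℕ} (n : Fin r → ℕ) : SphereProd n → PPS n := Quotient.mk _

/-- The setoid on the sphere `Sᵏ` identifying antipodal points. -/
def rpSetoid (k : ℕ) : Setoid (Metric.sphere (0 : EuclideanSpace ℝ (Fin (k + 1))) 1) :=
  ⟨fun x y => y = x ∨ y = -x, by
    constructor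
    · intro x; exact Or.inl rfl
    · rintro x y (rfl | rfl)
      · exact Or.inl rfl
      · right; simp
    · rintro x y z (rfl | rfl) (rfl | rfl)
      · exact Or.inl rfl
      · exact Or.inr rfl
      · exact Or.inr rfl
      · left; simp⟩

/-- Real projective space `Pᵏ` as the quotient of the sphere `Sᵏ` by the antipodal map. -/
def RP (k : ℕ) : Type := Quotient (rpSetoid k)

instance (k : ℕ) : TopologicalSpace (RP k) := instTopologicalSpaceQuotient

/-- The quotient map `Sᵏ → Pᵏ`. -/
def rpMk (k : ℕ) : Metric.sphere (0 : EuclideanSpace ℝ (Fin (k + 1))) 1 → RP k :=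
  Quotient.mk _

/-- A continuous map `g : P_{n̄} × P_{m̄} → Pᵏ` is *axial* if it corresponds to the
cohomology class `x ⊗ 1 + 1 ⊗ x`; equivalently (and this is the formulation used here),
if it admits a continuous lift `g̃ : S_{n̄} × S_{m̄} → Sᵏ` which is `ℤ/2`-equivariant in
each variable separately: `g̃(-x, y) = g̃(x, -y) = -g̃(x, y)`. -/
def IsAxialMap {r s : ℕ} (n : Fin r → ℕ) (m : Fin s → ℕ) (k : ℕ)
    (g : PPS n × PPS m → RP k) : Prop :=
  Continuous g ∧
  ∃ gt : SphereProd n × SphereProd m →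
      Metric.sphere (0 : EuclideanSpace ℝ (Fin (k + 1))) 1,
    Continuous gt ∧
    (∀ x y, gt (-x, y) = -gt (x, y)) ∧
    (∀ x y, gt (x, -y) = -gt (x, y)) ∧
    (∀ x y, rpMk k (gt (x, y)) = g (ppsMk n x, ppsMk m y))

/-- A continuous map `α : P_{n̄} × P^{N} → P^{L}` is a *Hopf-type map* if it classifies
the Hopf line bundle of the projectivization `P((N+1)ξ_{n̄}) = P_{n̄} × P^{N}`;
equivalently (the formulation used here), if it is double covered by a continuous map
`H : S_{n̄} × S^{N} → S^{L}` satisfying `H(-x, -v) = H(x, v)` (so that `H` descends to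
the Borel construction `S_{n̄} ×_{ℤ/2} S^{N}`, the sphere bundle of the Hopf line
bundle) and `H(x, -v) = -H(x, v)` (equivariance with respect to the deck
transformations). -/
def IsHopfTypeMap {r : ℕ} (n : Fin r → ℕ) (N L : ℕ)
    (α : PPS n × RP N → RP L) : Prop :=
  Continuous α ∧
  ∃ H : SphereProd n × Metric.sphere (0 : EuclideanSpace ℝ (Fin (N + 1))) 1 →
      Metric.sphere (0 : EuclideanSpace ℝ (Fin (L + 1))) 1,
    Continuous H ∧
    (∀ x v, H (-x, -v) = H (x, v)) ∧
    (∀ x v, H (x, -v) = -H (x, v)) ∧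
    (∀ x v, rpMk L (H (x, v)) = α (ppsMk n x, rpMk N v))

/-- A continuous map `g : Pᵃ × Pᵇ → Pᵏ` of real projective spaces is *axial* if it
represents `x ⊗ 1 + 1 ⊗ x` in mod 2 cohomology; equivalently (the formulation used
here), if it lifts to a continuous map `g̃ : Sᵃ × Sᵇ → Sᵏ` which is `ℤ/2`-equivariant
in each variable separately. -/
def IsAxialMapRP (a b k : ℕ) (g : RP a × RP b → RP k) : Prop :=
  Continuous g ∧
  ∃ gt : Metric.sphere (0 : EuclideanSpace ℝ (Fin (a + 1))) 1 ×
      Metric.sphere (0 : EuclideanSpace ℝ (Fin (b + 1))) 1 →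
      Metric.sphere (0 : EuclideanSpace ℝ (Fin (k + 1))) 1,
    Continuous gt ∧
    (∀ x y, gt (-x, y) = -gt (x, y)) ∧
    (∀ x y, gt (x, -y) = -gt (x, y)) ∧
    (∀ x y, rpMk k (gt (x, y)) = g (rpMk a x, rpMk b y))

open scoped Manifold

section Retraction

/-- The radial retraction `y ↦ y / ‖y‖` onto the unit sphere, with value `p` at the origin. -/
def sphereRetract {E : Type*} [NormedAddCommGroup E] [NormedSpace ℝ E]
    (p : sphere (0 : E) 1) (y : E) : sphere (0 : E) 1 :=
  open Classical in
  if h : y = 0 then p else ⟨‖y‖⁻¹ • y, by simp [norm_smul, h]⟩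

section Normed

variable {E : Type*} [NormedAddCommGroup E] [NormedSpace ℝ E] (p : sphere (0 : E) 1)

theorem coe_sphereRetract {y : E} (hy : y ≠ 0) :
    (sphereRetract p y : E) = ‖y‖⁻¹ • y := by
  simp [sphereRetract, hy]

theorem sphereRetract_coe (x : sphere (0 : E) 1) : sphereRetract p (x : E) = x := by
  ext1
  rw [coe_sphereRetract p (ne_zero_of_mem_unit_sphere x), norm_eq_of_mem_sphere]
  simp

theorem sphereRetract_neg {y : E} (hy : y ≠ 0) :
    sphereRetract p (-y) = -sphereRetract p y := by
  ext1
  simp [coe_sphereRetract p hy, coe_sphereRetract p (neg_ne_zero.2 hy)]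

end Normed

variable {E : Type*} [NormedAddCommGroup E] [InnerProductSpace ℝ E]

theorem hasFDerivAt_normalize {x v : E} (hx : ‖x‖ = 1) (hv : inner ℝ x v = 0) :
    ∃ A : E →L[ℝ] E, HasFDerivAt (fun y : E => ‖y‖⁻¹ • y) A x ∧ A v = v := by
  have hx0 : x ≠ 0 := by rintro rfl; simp at hx
  have h1 : DifferentiableAt ℝ (fun y : E => ‖y‖) x :=
    (contDiffAt_norm ℝ hx0 (n := 1)).differentiableAt one_ne_zero
  have h2 := (hasStrictFDerivAt_norm_sq x).hasFDerivAt
  have h3 := (h1.hasFDerivAt.pow 2).unique h2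
  have h4 : fderiv ℝ (fun y : E => ‖y‖) x v = 0 := by
    simpa [hx, hv] using DFunLike.congr_fun h3 v
  have h5 := ((hasDerivAt_inv (norm_ne_zero_iff.2 hx0)).comp_hasFDerivAt x h1.hasFDerivAt).smul
    (hasFDerivAt_id x)
  exact ⟨_, h5, by simp [h4, hx]⟩

theorem contMDiffAt_sphereRetract {k : ℕ} [Fact (Module.finrank ℝ E = k + 1)]
    (p : sphere (0 : E) 1) {m : WithTop ℕ∞} {y : E} (hy : y ≠ 0) :
    ContMDiffAt 𝓘(ℝ, E) (𝓡 k) m (sphereRetract p) y := by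
  let U : TopologicalSpace.Opens E := ⟨{0}ᶜ, isOpen_compl_singleton⟩
  have hU : ∀ z : U, (z : E) ≠ 0 := fun z => z.2
  have h1 : ContMDiff 𝓘(ℝ, E) 𝓘(ℝ, E) m (fun z : U => ‖(z : E)‖⁻¹ • (z : E)) := by
    intro z
    have : ContMDiffAt 𝓘(ℝ, E) 𝓘(ℝ, E) m (fun z : E => ‖z‖⁻¹ • z) z :=
      (((contDiffAt_norm ℝ (hU z)).inv (norm_ne_zero_iff.2 (hU z))).smul
        contDiffAt_id).contMDiffAt
    exact contMDiffAt_subtype_iff.2 this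
  have h2 := h1.codRestrict_sphere (n := k) (fun z => by simp [norm_smul, hU z])
  have h3 : ContMDiff 𝓘(ℝ, E) (𝓡 k) m (fun z : U => sphereRetract p (z : E)) :=
    h2.congr fun z => Subtype.ext (coe_sphereRetract p (hU z))
  exact (contMDiffAt_subtype_iff (x := (⟨y, hy⟩ : U))).1 (h3 _)

end Retraction

section PiManifold

variable {ι : Type*} [Fintype ι] {E H M : ι → Type*}
  [∀ i, NormedAddCommGroup (E i)] [∀ i, NormedSpace ℝ (E i)]
  [∀ i, TopologicalSpace (H i)] [∀ i, TopologicalSpace (M i)] [∀ i, ChartedSpace (H i) (M i)]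
  {J : ∀ i, ModelWithCorners ℝ (E i) (H i)} {m : WithTop ℕ∞}

theorem contMDiffAt_pi_of_components {F : Type*} [NormedAddCommGroup F] [NormedSpace ℝ F]
    {f : F → ∀ i, M i} {y : F}
    (h : ∀ i, ContMDiffAt 𝓘(ℝ, F) (J i) m (fun z => f z i) y) :
    ContMDiffAt 𝓘(ℝ, F) (ModelWithCorners.pi J) m f y := by
  rw [contMDiffAt_iff_target]
  refine ⟨continuousAt_pi.2 fun i => (h i).continuousAt, ?_⟩
  exact contMDiffAt_pi_space.2 fun i => (contMDiffAt_iff_target.1 (h i)).2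

theorem mdifferentiableAt_pi_eval (x : ∀ i, M i) (i : ι) :
    MDifferentiableAt (ModelWithCorners.pi J) (J i) (fun z : ∀ i, M i => z i) x := by
  rw [mdifferentiableAt_iff]
  refine ⟨(continuous_apply i).continuousAt, ?_⟩
  have h : DifferentiableWithinAt ℝ (fun z : ∀ i, E i => z i)
      (range (ModelWithCorners.pi J)) (extChartAt (ModelWithCorners.pi J) x x) :=
    (differentiableAt_apply i _).differentiableWithinAt
  refine h.congr_of_eventuallyEq_of_mem ?_ (mem_range_self _)
  filter_upwards [extChartAt_target_mem_nhdsWithin x] with z hz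
  rw [extChartAt_target] at hz
  obtain ⟨w, hw⟩ := hz.2
  refine (extChartAt (J i) (x i)).right_inv ?_
  rw [extChartAt_target]
  exact ⟨hz.1 i (mem_univ i), w i, congrFun hw i⟩

end PiManifold

/-- Linear maps `L x`, odd in `x` and injective on the tangent space at `x`, induced by an
immersion of `S_{n̄}` which is invariant under the antipodal involution. -/
theorem exists_odd_tangent_family {r : ℕ} (n : Fin r → ℕ) (M : ℕ)
    (f : SphereProd n → EuclideanSpace ℝ (Fin M))
    (hf : ContMDiff (ModelWithCorners.pi fun i => 𝓡 (n i))
      (𝓘(ℝ, EuclideanSpace ℝ (Fin M))) (⊤ : ℕ∞) f)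
    (hinv : ∀ x : SphereProd n, f (-x) = f x)
    (himm : ∀ x : SphereProd n,
      Function.Injective (mfderiv (ModelWithCorners.pi fun i => 𝓡 (n i))
        (𝓘(ℝ, EuclideanSpace ℝ (Fin M))) f x)) :
    ∃ L : SphereProd n →
        ((Π i, EuclideanSpace ℝ (Fin (n i + 1))) →L[ℝ] EuclideanSpace ℝ (Fin M)),
      Continuous L ∧ (∀ x, L (-x) = -L x) ∧
      ∀ x v, (∀ i, inner ℝ (x i : EuclideanSpace ℝ (Fin (n i + 1))) (v i) = 0) →
        L x v = 0 → v = 0 := by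
  have p : SphereProd n := fun i => ⟨EuclideanSpace.single 0 1, by simp⟩
  let ρ : (Π i, EuclideanSpace ℝ (Fin (n i + 1))) → SphereProd n :=
    fun y i => sphereRetract (p i) (y i)
  let c : SphereProd n → (Π i, EuclideanSpace ℝ (Fin (n i + 1))) := fun x i => x i
  let U : Set (Π i, EuclideanSpace ℝ (Fin (n i + 1))) := {y | ∀ i, y i ≠ 0}
  have hUo : IsOpen U := by
    simp only [U, ofPred_forall]
    exact isOpen_iInter_of_finite fun i =>
      isOpen_compl_singleton.preimage (continuous_apply i)
  have hcU : ∀ x, c x ∈ U := fun x i => ne_zero_of_mem_unit_sphere (x i)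
  have hc : Continuous c := by fun_prop
  have hρc : ∀ x, ρ (c x) = x := fun x => funext fun i => sphereRetract_coe _ _
  have hρ : ∀ y ∈ U, ContMDiffAt 𝓘(ℝ, Π i, EuclideanSpace ℝ (Fin (n i + 1)))
      (ModelWithCorners.pi fun i => 𝓡 (n i)) (⊤ : ℕ∞) ρ y := fun y hy =>
    contMDiffAt_pi_of_components fun i =>
      have := Fact.mk (finrank_euclideanSpace_fin (𝕜 := ℝ) (n := n i + 1))
      (contMDiffAt_sphereRetract (k := n i) (p i) (hy i)).comp y
        (contDiffAt_pi.1 contDiffAt_id i).contMDiffAt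
  have hF : ∀ y ∈ U, ContDiffAt ℝ (⊤ : ℕ∞) (f ∘ ρ) y := fun y hy =>
    ((hf (ρ y)).comp y (hρ y hy)).contDiffAt
  refine ⟨fun x => fderiv ℝ (f ∘ ρ) (c x), ?_, fun x => ?_, fun x v hxv hv => ?_⟩
  · have h : ContinuousOn (fderiv ℝ (f ∘ ρ)) U :=
      ContDiffOn.continuousOn_fderiv_of_isOpen
        (fun y hy => (hF y hy).contDiffWithinAt) hUo (by simp)
    exact h.comp_continuous hc hcU
  · have h : (fun y => (f ∘ ρ) (-y)) =ᶠ[nhds (c x)] f ∘ ρ := by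
      filter_upwards [hUo.mem_nhds (hcU x)] with y hy
      have : ρ (-y) = -ρ y := funext fun i => sphereRetract_neg _ (hy i)
      simp [this, hinv]
    have h2 : -fderiv ℝ (f ∘ ρ) (-c x) = fderiv ℝ (f ∘ ρ) (c x) := by
      have := fderiv_comp_smul (𝕜 := ℝ) (f := f ∘ ρ) (x := c x) (-1)
      simp only [neg_smul, one_smul] at this
      exact this.symm.trans h.fderiv_eq
    have h3 : c (-x) = -c x := by ext1 i; simp [c]
    simp only [h3, ← h2, neg_neg]
  · have hdρ := (hρ _ (hcU x)).mdifferentiableAt (by simp)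
    have h1 : mfderiv 𝓘(ℝ, Π i, EuclideanSpace ℝ (Fin (n i + 1)))
        (ModelWithCorners.pi fun i => 𝓡 (n i)) ρ (c x) v = 0 := by
      apply himm (ρ (c x))
      have := mfderiv_comp (c x) ((hf (ρ (c x))).mdifferentiableAt (by simp)) hdρ
      rw [mfderiv_eq_fderiv] at this
      rw [map_zero]
      exact (DFunLike.congr_fun this v).symm.trans hv
    ext1 i
    obtain ⟨A, hA, hAv⟩ := hasFDerivAt_normalize (norm_eq_of_mem_sphere (x i)) (hxv i)
    have hce : MDifferentiableAt (ModelWithCorners.pi fun i => 𝓡 (n i))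
        𝓘(ℝ, EuclideanSpace ℝ (Fin (n i + 1)))
        (fun z : SphereProd n => (z i : EuclideanSpace ℝ (Fin (n i + 1)))) (ρ (c x)) :=
      have := Fact.mk (finrank_euclideanSpace_fin (𝕜 := ℝ) (n := n i + 1))
      MDifferentiableAt.comp _ ((contMDiff_coe_sphere (E := EuclideanSpace ℝ (Fin (n i + 1)))
          (n := n i) (m := 1) _).mdifferentiableAt one_ne_zero)
        (mdifferentiableAt_pi_eval _ i)
    have h2 := mfderiv_comp (c x) hce hdρ
    rw [mfderiv_eq_fderiv] at h2
    have h3 : (fun z : SphereProd n => (z i : EuclideanSpace ℝ (Fin (n i + 1)))) ∘ ρ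
        =ᶠ[nhds (c x)] fun y => ‖y i‖⁻¹ • y i := by
      filter_upwards [hUo.mem_nhds (hcU x)] with y hy
      exact coe_sphereRetract _ (hy i)
    have hp : HasFDerivAt (fun y : Π i, EuclideanSpace ℝ (Fin (n i + 1)) => y i)
        (ContinuousLinearMap.proj i) (c x) := hasFDerivAt_apply (𝕜 := ℝ) i (c x)
    have h4 : HasFDerivAt (fun y : Π i, EuclideanSpace ℝ (Fin (n i + 1)) => ‖y i‖⁻¹ • y i)
        (A.comp (ContinuousLinearMap.proj i)) (c x) :=
      HasFDerivAt.comp (c x) (g := fun y => ‖y‖⁻¹ • y) hA hp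
    rw [h3.fderiv_eq, h4.fderiv] at h2
    have h5 := DFunLike.congr_fun h2 v
    refine hAv.symm.trans (h5.trans ((congrArg (mfderiv _ _ _ _) h1).trans ?_))
    exact map_zero _

theorem isOpenQuotientMap_mk_of_antipodal {X : Type*} [TopologicalSpace X] [InvolutiveNeg X]
    [ContinuousNeg X] (S : Setoid X) (hS : ∀ x y, S x y ↔ y = x ∨ y = -x) :
    IsOpenQuotientMap (Quotient.mk S) := by
  refine ⟨Quotient.mk_surjective, continuous_quotient_mk', fun V hV => ?_⟩
  have h : Quotient.mk S ⁻¹' (Quotient.mk S '' V) = V ∪ Neg.neg ⁻¹' V := by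
    ext x
    constructor
    · rintro ⟨y, hy, hyx⟩
      rcases (hS _ _).1 (Quotient.exact hyx) with rfl | rfl
      · exact Or.inl hy
      · right; simpa using hy
    · rintro (hx | hx)
      · exact ⟨x, hx, rfl⟩
      · exact ⟨-x, hx, Quotient.sound ((hS _ _).2 (Or.inr (neg_neg x).symm))⟩
  exact isOpen_coinduced.2 (h ▸ hV.union (hV.preimage continuous_neg))

theorem isOpenQuotientMap_ppsMk {r : ℕ} (n : Fin r → ℕ) : IsOpenQuotientMap (ppsMk n) :=
  isOpenQuotientMap_mk_of_antipodal _ fun _ _ => Iff.rfl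

theorem isOpenQuotientMap_rpMk (k : ℕ) : IsOpenQuotientMap (rpMk k) :=
  isOpenQuotientMap_mk_of_antipodal _ fun _ _ => Iff.rfl

theorem rpMk_neg {k : ℕ} (x : sphere (0 : EuclideanSpace ℝ (Fin (k + 1))) 1) :
    rpMk k (-x) = rpMk k x :=
  Quotient.sound (Or.inr (neg_neg x).symm)

theorem exists_isHopfTypeMap_of_lift {r : ℕ} (n : Fin r → ℕ) (N L : ℕ)
    (H : SphereProd n × sphere (0 : EuclideanSpace ℝ (Fin (N + 1))) 1 →
      sphere (0 : EuclideanSpace ℝ (Fin (L + 1))) 1)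
    (hH : Continuous H) (h1 : ∀ x v, H (-x, -v) = H (x, v))
    (h2 : ∀ x v, H (x, -v) = -H (x, v)) :
    ∃ α : PPS n × RP N → RP L, IsHopfTypeMap n N L α := by
  have h3 : ∀ x v, H (-x, v) = -H (x, v) := fun x v => by
    rw [← h1, neg_neg, h2]
  let α : PPS n × RP N → RP L := fun q =>
    Quotient.liftOn₂ q.1 q.2 (fun x v => rpMk L (H (x, v))) <| by
      rintro x v y w (rfl | rfl) (rfl | rfl) <;> simp [h1, h2, h3, rpMk_neg]
  have hq := (isOpenQuotientMap_ppsMk n).prodMap (isOpenQuotientMap_rpMk N)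
  refine ⟨α, hq.isQuotientMap.continuous_iff.2 ?_, H, hH, h1, h2, fun x v => rfl⟩
  exact (isOpenQuotientMap_rpMk L).continuous.comp hH

/-- If the projective product manifold `P_{n̄}` admits a smooth immersion into `ℝ^M`
(equivalently, since `S_{n̄} → P_{n̄}` is a double covering and a local diffeomorphism:
there is a smooth immersion `f : S_{n̄} → ℝ^M` invariant under the diagonal antipodal
involution), then there exists a Hopf-type map
`P_{n̄} × P^{|n̄|+r-1} → P^{M+r-1}`. -/
theorem stmt14 (r : ℕ) (hr : 0 < r) (n : Fin r → ℕ)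
    (hpos : ∀ i, 1 ≤ n i) (hmono : Monotone n) (M : ℕ)
    (f : SphereProd n → EuclideanSpace ℝ (Fin M))
    (hf : ContMDiff (ModelWithCorners.pi fun i => 𝓡 (n i))
      (𝓘(ℝ, EuclideanSpace ℝ (Fin M))) (⊤ : ℕ∞) f)
    (hinv : ∀ x : SphereProd n, f (-x) = f x)
    (himm : ∀ x : SphereProd n,
      Function.Injective (mfderiv (ModelWithCorners.pi fun i => 𝓡 (n i))
        (𝓘(ℝ, EuclideanSpace ℝ (Fin M))) f x)) :
    ∃ α : PPS n × RP ((∑ i, n i) + r - 1) → RP (M + r - 1),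
      IsHopfTypeMap n ((∑ i, n i) + r - 1) (M + r - 1) α := by
  obtain ⟨D, hDc, hDneg, hDinj⟩ := exists_odd_tangent_family n M f hf hinv himm
  let e₁ : EuclideanSpace ℝ (Fin ((∑ i, n i) + r - 1 + 1)) ≃L[ℝ]
      (Π i, EuclideanSpace ℝ (Fin (n i + 1))) :=
    ContinuousLinearEquiv.ofFinrankEq (by
      simp [Module.finrank_pi_fintype, Finset.sum_add_distrib]; omega)
  let e₂ : (EuclideanSpace ℝ (Fin M) × (Fin r → ℝ)) ≃L[ℝ]
      EuclideanSpace ℝ (Fin (M + r - 1 + 1)) :=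
    ContinuousLinearEquiv.ofFinrankEq (by simp; omega)
  let Φ : SphereProd n × EuclideanSpace ℝ (Fin ((∑ i, n i) + r - 1 + 1)) →
      EuclideanSpace ℝ (Fin (M + r - 1 + 1)) := fun q =>
    e₂ (D q.1 (e₁ q.2), fun i => inner ℝ (q.1 i : EuclideanSpace ℝ (Fin (n i + 1))) (e₁ q.2 i))
  have hΦc : Continuous Φ := by
    refine e₂.continuous.comp (Continuous.prodMk ?_ ?_)
    · exact (hDc.comp continuous_fst).clm_apply (e₁.continuous.comp continuous_snd)
    · fun_prop
  have hΦ0 : ∀ x v, v ≠ 0 → Φ (x, v) ≠ 0 := fun x v hv h => by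
    have h' := (map_eq_zero_iff _ e₂.injective).1 h
    have := hDinj x (e₁ v) (fun i => congrFun (congrArg Prod.snd h') i) (congrArg Prod.fst h')
    exact hv ((map_eq_zero_iff _ e₁.injective).1 this)
  have hΦx : ∀ x v, Φ (-x, v) = -Φ (x, v) := fun x v => by
    simp only [Φ, hDneg, ← map_neg]
    congr 1
    ext1
    · simp
    · ext1 i; simp
  have hΦv : ∀ x v, Φ (x, -v) = -Φ (x, v) := fun x v => by
    simp only [Φ, ← map_neg]
    congr 1
    ext1
    · simp
    · ext1 i; simp
  have hne : ∀ q : SphereProd n ×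
      sphere (0 : EuclideanSpace ℝ (Fin ((∑ i, n i) + r - 1 + 1))) 1, Φ (q.1, q.2) ≠ 0 :=
    fun q => hΦ0 _ _ (ne_zero_of_mem_unit_sphere q.2)
  refine exists_isHopfTypeMap_of_lift n _ _
    (fun q => ⟨‖Φ (q.1, q.2)‖⁻¹ • Φ (q.1, q.2), by simp [norm_smul, hne q]⟩) ?_ ?_ ?_
  · have h : Continuous fun q : SphereProd n ×
        sphere (0 : EuclideanSpace ℝ (Fin ((∑ i, n i) + r - 1 + 1))) 1 => Φ (q.1, q.2) :=
      hΦc.comp (by fun_prop)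
    exact ((h.norm.inv₀ fun q => norm_ne_zero_iff.2 (hne q)).smul h).subtype_mk _
  · intro x v
    ext1
    simp [hΦx, hΦv]
  · intro x v
    ext1
    simp [hΦv]

end
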